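/- (Graver's optimality criterion.) Let A be an integer m×N matrix, w, l, u ∈ ℤ^N with finite bounds, b ∈ ℤ^m, and let x be feasible for the integer program min{w·y : Ay = b, l ≤ y ≤ u, y ∈ ℤ^N}. Then x is optimal if and only if there is no element g ∈ 𝒢(A) with l ≤ x + g ≤ u and w·g < 0. -/

import Mathlib

open Matrix

/-- The conformal (sign-compatible) partial order `x ⊑ y` on integer vectors:
`x k * y k ≥ 0` and `|x k| ≤ |y k|` for every coordinate `k`. -/
def ConformalLe {ν : Type*} (x y : ν → ℤ) : Prop :=
  ∀ k, 0 ≤ x k * y k ∧ |x k| ≤ |y k|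

/-- The Graver basis of an integer matrix `A`: the set of `⊑`-minimal elements of
`{x : A x = 0, x ≠ 0}`. -/
def GraverBasis {μ ν : Type*} [Fintype ν] (A : Matrix μ ν ℤ) : Set (ν → ℤ) :=
  {x | A.mulVec x = 0 ∧ x ≠ 0 ∧
    ∀ y, A.mulVec y = 0 → y ≠ 0 → ConformalLe y x → y = x}

/-- The `ι`-fold product of the bimatrix with blocks `A1` (first block, `r × τ`) and
`A2` (second block, `s × τ`): the first `r` rows are `(A1 A1 ⋯ A1)` and the remaining
rows form a block-diagonal matrix with a copy of `A2` for each index in `ι`. -/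
def nFold {r s : ℕ} {τ : Type*} (A1 : Matrix (Fin r) τ ℤ) (A2 : Matrix (Fin s) τ ℤ)
    (ι : Type*) [DecidableEq ι] : Matrix (Fin r ⊕ ι × Fin s) (ι × τ) ℤ :=
  Matrix.of fun i jt =>
    match i with
    | Sum.inl a => A1 a jt.2
    | Sum.inr (k, c) => if jt.1 = k then A2 c jt.2 else 0

/-- The `i`-th brick of a vector indexed by `ι × τ`. -/
def brick {ι τ : Type*} (x : ι × τ → ℤ) (i : ι) : τ → ℤ := fun j => x (i, j)

/-- The Graver complexity of the bimatrix `(A1, A2)`: the largest number of nonzero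
bricks appearing in any element of the Graver basis of any `n`-fold product. -/
noncomputable def graverComplexity {r s t : ℕ} (A1 : Matrix (Fin r) (Fin t) ℤ)
    (A2 : Matrix (Fin s) (Fin t) ℤ) : ℕ :=
  sSup {k : ℕ | ∃ (n : ℕ) (g : Fin n × Fin t → ℤ),
    g ∈ GraverBasis (nFold A1 A2 (Fin n)) ∧
    k = {i : Fin n | brick g i ≠ 0}.ncard}

/-- `Z(A)`: the set of all vectors in `ℤ^t` that are sums of at most `g(A)` elements
of the Graver basis of `A2`. -/
noncomputable def ZSet {r s t : ℕ} (A1 : Matrix (Fin r) (Fin t) ℤ)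
    (A2 : Matrix (Fin s) (Fin t) ℤ) : Set (Fin t → ℤ) :=
  {z | ∃ L : List (Fin t → ℤ), L.length ≤ graverComplexity A1 A2 ∧
    (∀ h ∈ L, h ∈ GraverBasis A2) ∧ z = L.sum}

theorem conformalLe_iff {ν : Type*} {x y : ν → ℤ} :
    ConformalLe x y ↔ ∀ k, (0 ≤ x k ∧ x k ≤ y k) ∨ (y k ≤ x k ∧ x k ≤ 0) := by
  refine forall_congr' fun k => ?_
  constructor
  · rintro ⟨hs, ha⟩
    rcases mul_nonneg_iff.mp hs with ⟨hx, hy⟩ | ⟨hx, hy⟩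
    · rw [abs_of_nonneg hx, abs_of_nonneg hy] at ha
      exact Or.inl ⟨hx, ha⟩
    · rw [abs_of_nonpos hx, abs_of_nonpos hy] at ha
      exact Or.inr ⟨neg_le_neg_iff.mp ha, hx⟩
  · rintro (⟨hx, hxy⟩ | ⟨hyx, hx⟩)
    · exact ⟨mul_nonneg hx (hx.trans hxy), abs_le_abs_of_nonneg hx hxy⟩
    · exact ⟨mul_nonneg_of_nonpos_of_nonpos hx (hyx.trans hx), abs_le_abs_of_nonpos hx hyx⟩

theorem ConformalLe.refl {ν : Type*} (x : ν → ℤ) : ConformalLe x x :=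
  fun k => ⟨mul_self_nonneg (x k), le_rfl⟩

theorem ConformalLe.trans {ν : Type*} {x y z : ν → ℤ} (hxy : ConformalLe x y)
    (hyz : ConformalLe y z) : ConformalLe x z := by
  rw [conformalLe_iff] at *
  intro k
  have := hxy k
  have := hyz k
  lia

theorem ConformalLe.sub_left {ν : Type*} {x y : ν → ℤ} (h : ConformalLe x y) :
    ConformalLe (y - x) y := by
  rw [conformalLe_iff] at *
  intro k
  have := h k
  simp only [Pi.sub_apply]
  lia

theorem ConformalLe.sum_natAbs_lt {ν : Type*} [Fintype ν] {x y : ν → ℤ}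
    (h : ConformalLe x y) (hne : x ≠ y) : ∑ k, (x k).natAbs < ∑ k, (y k).natAbs := by
  rw [conformalLe_iff] at h
  obtain ⟨i, hi⟩ := Function.ne_iff.mp hne
  refine Finset.sum_lt_sum (fun k _ => ?_) ⟨i, Finset.mem_univ i, ?_⟩
  · have := h k
    lia
  · have := h i
    lia

theorem exists_mem_graverBasis_conformalLe_dotProduct_neg {μ ν : Type*} [Fintype ν]
    (A : Matrix μ ν ℤ) (w v : ν → ℤ) (hv : A.mulVec v = 0) (hw : w ⬝ᵥ v < 0) :
    ∃ g ∈ GraverBasis A, ConformalLe g v ∧ w ⬝ᵥ g < 0 := by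
  induction hn : ∑ k, (v k).natAbs using Nat.strong_induction_on generalizing v with
  | _ n ih =>
    subst hn
    by_cases hg : v ∈ GraverBasis A
    · exact ⟨v, hg, .refl v, hw⟩
    have hv0 : v ≠ 0 := by
      rintro rfl
      simp at hw
    obtain ⟨y, hy, hy0, hyv, hne⟩ :
        ∃ y, A.mulVec y = 0 ∧ y ≠ 0 ∧ ConformalLe y v ∧ y ≠ v := by
      by_contra! h
      exact hg ⟨hv, hv0, h⟩
    have descend : ∀ z, A.mulVec z = 0 → ConformalLe z v → z ≠ v → w ⬝ᵥ z < 0 →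
        ∃ g ∈ GraverBasis A, ConformalLe g v ∧ w ⬝ᵥ g < 0 := by
      intro z hz hzv hzne hwz
      obtain ⟨g, hgA, hgz, hwg⟩ := ih _ (hzv.sum_natAbs_lt hzne) z hz hwz rfl
      exact ⟨g, hgA, hgz.trans hzv, hwg⟩
    by_cases hwy : w ⬝ᵥ y < 0
    · exact descend y hy hyv hne hwy
    · refine descend (v - y) (by rw [mulVec_sub, hv, hy, sub_zero]) hyv.sub_left
        (by simpa using hy0) ?_
      rw [dotProduct_sub]
      lia

/-- **Graver's optimality criterion.** A feasible point `x` of the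
integer program `min{w·y : Ay = b, l ≤ y ≤ u, y ∈ ℤ^N}` is optimal if and only if
there is no Graver basis element `g ∈ 𝒢(A)` with `l ≤ x + g ≤ u` and `w·g < 0`. -/
theorem graver_optimality_criterion {m N : ℕ} (A : Matrix (Fin m) (Fin N) ℤ)
    (w l u : Fin N → ℤ) (b : Fin m → ℤ)
    (x : Fin N → ℤ) (hxb : A.mulVec x = b) (hxl : l ≤ x) (hxu : x ≤ u) :
    (∀ y : Fin N → ℤ, A.mulVec y = b → l ≤ y → y ≤ u → w ⬝ᵥ x ≤ w ⬝ᵥ y) ↔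
      ¬∃ g ∈ GraverBasis A, l ≤ x + g ∧ x + g ≤ u ∧ w ⬝ᵥ g < 0 := by
  constructor
  · rintro hopt ⟨g, hg, hl, hu, hwg⟩
    have := hopt (x + g) (by rw [mulVec_add, hxb, hg.1, add_zero]) hl hu
    rw [dotProduct_add] at this
    lia
  · intro hno y hyb hyl hyu
    by_contra! hlt
    obtain ⟨g, hg, hgv, hwg⟩ :=
      exists_mem_graverBasis_conformalLe_dotProduct_neg A w (y - x)
        (by rw [mulVec_sub, hyb, hxb, sub_self]) (by rw [dotProduct_sub]; lia)
    rw [conformalLe_iff] at hgv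
    refine hno ⟨g, hg, fun k => ?_, fun k => ?_, hwg⟩ <;>
    · have := hgv k
      have := hxl k
      have := hxu k
      have := hyl k
      have := hyu k
      simp only [Pi.sub_apply, Pi.add_apply] at *
      lia
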